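/- For every element x of a Garside group G of finite type, cyclic sliding does not decrease the infimum, does not increase the supremum, and does not increase the canonical length: inf(𝔰(x)) ≥ inf(x), sup(𝔰(x)) ≤ sup(x), and ℓ(𝔰(x)) ≤ ℓ(x). -/

import Mathlib

/-- A Garside structure of finite type on a group `G`: a submonoid `P` of positive
elements with `P ∩ P⁻¹ = {1}`, such that the prefix order `a ⪯ b ↔ a⁻¹ * b ∈ P` is a
lattice order (with meet `wedge` and join `vee`), together with a Garside element `Δ ∈ P`
whose set of prefixes (the simple elements) is finite and generates `G`, satisfying
`Δ⁻¹ P Δ = P`, and such that every nontrivial positive element has a finite norm. -/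
structure GarsideStructure (G : Type*) [Group G] where
  P : Set G
  one_mem : (1 : G) ∈ P
  mul_mem : ∀ {a b : G}, a ∈ P → b ∈ P → a * b ∈ P
  eq_one_of_mem_of_inv_mem : ∀ a : G, a ∈ P → a⁻¹ ∈ P → a = 1
  wedge : G → G → G
  vee : G → G → G
  wedge_le_left : ∀ a b : G, (wedge a b)⁻¹ * a ∈ P
  wedge_le_right : ∀ a b : G, (wedge a b)⁻¹ * b ∈ P
  le_wedge : ∀ a b c : G, c⁻¹ * a ∈ P → c⁻¹ * b ∈ P → c⁻¹ * wedge a b ∈ P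
  le_vee_left : ∀ a b : G, a⁻¹ * vee a b ∈ P
  le_vee_right : ∀ a b : G, b⁻¹ * vee a b ∈ P
  vee_le : ∀ a b c : G, a⁻¹ * c ∈ P → b⁻¹ * c ∈ P → (vee a b)⁻¹ * c ∈ P
  Δ : G
  Δ_mem : Δ ∈ P
  simples_finite : {s : G | s ∈ P ∧ s⁻¹ * Δ ∈ P}.Finite
  simples_generate : Subgroup.closure {s : G | s ∈ P ∧ s⁻¹ * Δ ∈ P} = (⊤ : Subgroup G)
  conj_Delta_mem : ∀ a : G, a ∈ P → Δ⁻¹ * a * Δ ∈ P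
  mem_of_conj_Delta_mem : ∀ a : G, Δ⁻¹ * a * Δ ∈ P → a ∈ P
  norm_bounded : ∀ x : G, x ∈ P → x ≠ 1 →
    ∃ n : ℕ, ∀ L : List G, (∀ a ∈ L, a ∈ P ∧ a ≠ 1) → L.prod = x → L.length ≤ n

namespace GarsideStructure

variable {G : Type*} [Group G] (gs : GarsideStructure G)

/-- The prefix order: `a ⪯ b`. -/
def pre (a b : G) : Prop := a⁻¹ * b ∈ gs.P

/-- The suffix order: `a ≽ b` (i.e. `b` is a suffix of `a`). -/
def rdvd (a b : G) : Prop := a * b⁻¹ ∈ gs.P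

/-- Greatest common divisor with respect to the suffix order `≽` : `a ∧↰ b`. -/
def rwedge (a b : G) : G := (gs.vee a⁻¹ b⁻¹)⁻¹

/-- Least common multiple with respect to the suffix order `≽` : `a ∨↰ b`. -/
def rvee (a b : G) : G := (gs.wedge a⁻¹ b⁻¹)⁻¹

/-- Simple elements: positive prefixes of `Δ`. -/
def simple (s : G) : Prop := s ∈ gs.P ∧ s⁻¹ * gs.Δ ∈ gs.P

/-- Atoms: nontrivial positive elements which cannot be decomposed in `P`. -/
def atom (a : G) : Prop := a ∈ gs.P ∧ a ≠ 1 ∧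
  ∀ b c : G, b ∈ gs.P → c ∈ gs.P → a = b * c → b = 1 ∨ c = 1

/-- `inf x` : the maximal integer `p` with `Δ^p ⪯ x`. -/
noncomputable def ginf (x : G) : ℤ := sSup {p : ℤ | gs.pre (gs.Δ ^ p) x}

/-- `sup x` : the minimal integer `p` with `x ⪯ Δ^p`. -/
noncomputable def gsup (x : G) : ℤ := sInf {p : ℤ | gs.pre x (gs.Δ ^ p)}

/-- Canonical length `ℓ(x) = sup(x) - inf(x)`. -/
noncomputable def glen (x : G) : ℤ := gs.gsup x - gs.ginf x

/-- `‖x‖` : the maximal number of factors in a decomposition of `x` as a product of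
nontrivial positive elements. -/
noncomputable def gnorm (x : G) : ℕ :=
  sSup {k : ℕ | ∃ L : List G, (∀ a ∈ L, a ∈ gs.P ∧ a ≠ 1) ∧ L.prod = x ∧ L.length = k}

/-- The summit infimum `inf_s(x)` : the maximum of `inf` over the conjugacy class of `x`. -/
noncomputable def ginfs (x : G) : ℤ :=
  sSup {p : ℤ | ∃ y : G, (∃ α : G, α⁻¹ * x * α = y) ∧ p = gs.ginf y}

/-- The summit supremum `sup_s(x)` : the minimum of `sup` over the conjugacy class of `x`. -/
noncomputable def gsups (x : G) : ℤ :=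
  sInf {p : ℤ | ∃ y : G, (∃ α : G, α⁻¹ * x * α = y) ∧ p = gs.gsup y}

/-- The preferred prefix `𝔭(x) = (xΔ^{-inf x}) ∧ (x⁻¹Δ^{sup x}) ∧ Δ`. -/
noncomputable def pp (x : G) : G :=
  gs.wedge (gs.wedge (x * gs.Δ ^ (-gs.ginf x)) (x⁻¹ * gs.Δ ^ gs.gsup x)) gs.Δ

/-- Cyclic (left) sliding `𝔰(x) = 𝔭(x)⁻¹ x 𝔭(x)`. -/
noncomputable def sl (x : G) : G := (gs.pp x)⁻¹ * x * gs.pp x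

/-- The preferred suffix `𝔭↰(x) = (Δ^{-inf x}x) ∧↰ (Δ^{sup x}x⁻¹) ∧↰ Δ`. -/
noncomputable def ps (x : G) : G :=
  gs.rwedge (gs.rwedge (gs.Δ ^ (-gs.ginf x) * x) (gs.Δ ^ gs.gsup x * x⁻¹)) gs.Δ

/-- Cyclic right sliding `𝔰↰(x) = 𝔭↰(x) x 𝔭↰(x)⁻¹`. -/
noncomputable def rsl (x : G) : G := gs.ps x * x * (gs.ps x)⁻¹

/-- The super summit set `SSS(x)` : conjugates of `x` with maximal infimum and minimal
supremum among all conjugates of `x`. -/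
def SSS (x : G) : Set G :=
  {y | (∃ α : G, α⁻¹ * x * α = y) ∧
    ∀ z : G, (∃ α : G, α⁻¹ * x * α = z) → gs.ginf z ≤ gs.ginf y ∧ gs.gsup y ≤ gs.gsup z}

/-- The set of sliding circuits `SC(x)` : conjugates `y` of `x` with `𝔰^m(y) = y` for
some `m ≥ 1`. -/
noncomputable def SC (x : G) : Set G :=
  {y | (∃ α : G, α⁻¹ * x * α = y) ∧ ∃ m : ℕ, 1 ≤ m ∧ (gs.sl)^[m] y = y}

/-- The transport `α^{(1)} = 𝔭(x)⁻¹ α 𝔭(x^α)` of `α` at `x`. -/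
noncomputable def transport (x α : G) : G := (gs.pp x)⁻¹ * α * gs.pp (α⁻¹ * x * α)

/-- Iterated transport `α^{(i)}` of `α` at `x`: `α^{(0)} = α` and `α^{(i+1)}` is the
transport of `α^{(i)}` at `𝔰^i(x)`. -/
noncomputable def transportIter (x α : G) : ℕ → G
  | 0 => α
  | i + 1 => gs.transport ((gs.sl)^[i] x) (transportIter x α i)

/-- `c` is the `⪯`-minimal element `c_s(y)` satisfying `s ⪯ c` and `y^c ∈ SC(x)`. -/
def IsMinSCConj (x y s c : G) : Prop :=
  gs.pre s c ∧ (c⁻¹ * y * c) ∈ gs.SC x ∧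
    ∀ d : G, gs.pre s d → (d⁻¹ * y * d) ∈ gs.SC x → gs.pre c d

/-- `s` is an indecomposable conjugator starting at `u`: `u^s ∈ SC(x)`, `s ≠ 1` and there
is no `t` with `1 ≺ t ≺ s` and `u^t ∈ SC(x)`. -/
def IsIndecomposableConjugator (x u s : G) : Prop :=
  (s⁻¹ * u * s) ∈ gs.SC x ∧ s ≠ 1 ∧
    ¬ ∃ t : G, (gs.pre 1 t ∧ t ≠ 1) ∧ (gs.pre t s ∧ t ≠ s) ∧ (t⁻¹ * u * t) ∈ gs.SC x

/-- `u` is the pullback of `s` at `y = 𝔰(z)` : the `⪯`-minimal positive element with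
`z^u ∈ SSS(x)` and `s ⪯ u^{(1)}` (transport at `z`). -/
def IsPullback (x z s u : G) : Prop :=
  u ∈ gs.P ∧ (u⁻¹ * z * u) ∈ gs.SSS x ∧ gs.pre s (gs.transport z u) ∧
    ∀ u' : G, u' ∈ gs.P → (u'⁻¹ * z * u') ∈ gs.SSS x → gs.pre s (gs.transport z u') →
      gs.pre u u'

/-- The pullback `s_{(1)}` of `s` at `y = 𝔰(z)`. -/
noncomputable def pullbackOne (x z s : G) : G :=
  @Classical.epsilon G ⟨1⟩ (fun u => gs.IsPullback x z s u)

/-- The `k`-fold pullback `s_{(k)}` of `s` at `y = 𝔰^k(z)` (an element at `z`):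
`s_{(0)} = s` and `s_{(k+1)}` is the pullback at `𝔰(z)` (relative to `z`) of the `k`-fold
pullback of `s` at `𝔰^k(𝔰(z)) = y`. -/
noncomputable def pullbackIter (x : G) : G → ℕ → G → G
  | _, 0, s => s
  | z, k + 1, s => gs.pullbackOne x z (pullbackIter x (gs.sl z) k s)

end GarsideStructure

namespace GarsideStructure

variable {G : Type*} [Group G] (gs : GarsideStructure G)

theorem zpow_conj_mem_iff (n : ℤ) {a : G} :
    gs.Δ ^ (-n) * a * gs.Δ ^ n ∈ gs.P ↔ a ∈ gs.P := by
  have step : ∀ b : G, gs.Δ⁻¹ * b * gs.Δ ∈ gs.P ↔ b ∈ gs.P := fun b =>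
    ⟨gs.mem_of_conj_Delta_mem b, gs.conj_Delta_mem b⟩
  induction n with
  | zero => simp
  | succ n ih =>
    refine Iff.trans ?_ ih
    rw [← step (gs.Δ ^ (-(n : ℤ)) * a * gs.Δ ^ (n : ℤ))]
    have h : gs.Δ ^ (-((n : ℤ) + 1)) * a * gs.Δ ^ ((n : ℤ) + 1) =
        gs.Δ⁻¹ * (gs.Δ ^ (-(n : ℤ)) * a * gs.Δ ^ (n : ℤ)) * gs.Δ := by group
    rw [h]
  | pred n ih =>
    refine Iff.trans ?_ ih
    rw [← step (gs.Δ ^ (-(-(n : ℤ) - 1)) * a * gs.Δ ^ (-(n : ℤ) - 1))]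
    have h : gs.Δ⁻¹ * (gs.Δ ^ (-(-(n : ℤ) - 1)) * a * gs.Δ ^ (-(n : ℤ) - 1)) * gs.Δ =
        gs.Δ ^ (-(-(n : ℤ))) * a * gs.Δ ^ (-(n : ℤ)) := by group
    rw [h]

theorem zpow_mul_mem_iff (n : ℤ) {a : G} : gs.Δ ^ n * a ∈ gs.P ↔ a * gs.Δ ^ n ∈ gs.P := by
  rw [← gs.zpow_conj_mem_iff n (a := gs.Δ ^ n * a)]
  simp

/-- Every element lies between two powers of the Garside element. -/
theorem exists_zpow_pre_and_pre_zpow (x : G) :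
    (∃ p : ℤ, gs.pre (gs.Δ ^ p) x) ∧ ∃ q : ℤ, gs.pre x (gs.Δ ^ q) := by
  have hx : x ∈ Subgroup.closure {s : G | s ∈ gs.P ∧ s⁻¹ * gs.Δ ∈ gs.P} := by
    rw [gs.simples_generate]
    trivial
  induction hx using Subgroup.closure_induction with
  | mem s hs => exact ⟨⟨0, by simpa [pre] using hs.1⟩, ⟨1, by simpa [pre] using hs.2⟩⟩
  | one => exact ⟨⟨0, by simpa [pre] using gs.one_mem⟩, ⟨0, by simpa [pre] using gs.one_mem⟩⟩
  | mul x y _ _ hx hy =>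
    obtain ⟨⟨p, hp⟩, ⟨q, hq⟩⟩ := hx
    obtain ⟨⟨p', hp'⟩, ⟨q', hq'⟩⟩ := hy
    refine ⟨⟨p + p', ?_⟩, ⟨q + q', ?_⟩⟩
    · have h := gs.mul_mem ((gs.zpow_conj_mem_iff p').2 hp) hp'
      unfold pre
      convert h using 1
      group
    · have h := gs.mul_mem hq' ((gs.zpow_conj_mem_iff q').2 hq)
      unfold pre
      convert h using 1
      group
  | inv x _ hx =>
    obtain ⟨⟨p, hp⟩, ⟨q, hq⟩⟩ := hx
    refine ⟨⟨-q, ?_⟩, ⟨-p, ?_⟩⟩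
    · unfold pre
      rw [← zpow_neg, neg_neg]
      exact (gs.zpow_mul_mem_iff q).2 hq
    · unfold pre at hp ⊢
      rw [inv_inv]
      rw [← zpow_neg] at hp
      exact (gs.zpow_mul_mem_iff (-p)).1 hp

theorem pow_Delta_mem (n : ℕ) : gs.Δ ^ n ∈ gs.P := by
  induction n with
  | zero => simpa using gs.one_mem
  | succ n ih => exact pow_succ gs.Δ n ▸ gs.mul_mem ih gs.Δ_mem

theorem nonneg_of_zpow_Delta_mem (hΔ : gs.Δ ≠ 1) {n : ℤ} (hn : gs.Δ ^ n ∈ gs.P) : 0 ≤ n := by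
  by_contra! h
  obtain ⟨k, rfl⟩ : ∃ k : ℕ, n = -((k : ℤ) + 1) := ⟨(-n - 1).toNat, by omega⟩
  refine hΔ (gs.eq_one_of_mem_of_inv_mem _ gs.Δ_mem ?_)
  convert gs.mul_mem hn (gs.pow_Delta_mem k) using 1
  group

theorem le_of_zpow_pre_of_pre_zpow (hΔ : gs.Δ ≠ 1) {x : G} {p q : ℤ}
    (hp : gs.pre (gs.Δ ^ p) x) (hq : gs.pre x (gs.Δ ^ q)) : p ≤ q := by
  have h := gs.mul_mem hp hq
  rw [mul_assoc, mul_inv_cancel_left, ← zpow_neg, ← zpow_add] at h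
  have := gs.nonneg_of_zpow_Delta_mem hΔ h
  omega

theorem bddAbove_zpow_pre (hΔ : gs.Δ ≠ 1) (x : G) : BddAbove {p : ℤ | gs.pre (gs.Δ ^ p) x} :=
  let ⟨q, hq⟩ := (gs.exists_zpow_pre_and_pre_zpow x).2
  ⟨q, fun _ hp => gs.le_of_zpow_pre_of_pre_zpow hΔ hp hq⟩

theorem bddBelow_pre_zpow (hΔ : gs.Δ ≠ 1) (x : G) : BddBelow {q : ℤ | gs.pre x (gs.Δ ^ q)} :=
  let ⟨p, hp⟩ := (gs.exists_zpow_pre_and_pre_zpow x).1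
  ⟨p, fun _ hq => gs.le_of_zpow_pre_of_pre_zpow hΔ hp hq⟩

theorem zpow_ginf_pre (hΔ : gs.Δ ≠ 1) (x : G) : gs.pre (gs.Δ ^ gs.ginf x) x :=
  Int.csSup_mem (gs.exists_zpow_pre_and_pre_zpow x).1 (gs.bddAbove_zpow_pre hΔ x)

theorem pre_zpow_gsup (hΔ : gs.Δ ≠ 1) (x : G) : gs.pre x (gs.Δ ^ gs.gsup x) :=
  Int.csInf_mem (gs.exists_zpow_pre_and_pre_zpow x).2 (gs.bddBelow_pre_zpow hΔ x)

theorem pre_trans {a b c : G} (hab : gs.pre a b) (hbc : gs.pre b c) : gs.pre a c := by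
  simpa [pre, mul_assoc] using gs.mul_mem hab hbc

theorem pp_pre_mul_zpow (x : G) : gs.pre (gs.pp x) (x * gs.Δ ^ (-gs.ginf x)) :=
  gs.pre_trans (gs.wedge_le_left _ _) (gs.wedge_le_left _ _)

theorem pp_pre_inv_mul_zpow (x : G) : gs.pre (gs.pp x) (x⁻¹ * gs.Δ ^ gs.gsup x) :=
  gs.pre_trans (gs.wedge_le_left _ _) (gs.wedge_le_right _ _)

theorem pp_mem (hΔ : gs.Δ ≠ 1) (x : G) : gs.pp x ∈ gs.P := by
  have hp : x * gs.Δ ^ (-gs.ginf x) ∈ gs.P := by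
    rw [← zpow_mul_mem_iff, zpow_neg]
    exact gs.zpow_ginf_pre hΔ x
  have h := gs.le_wedge _ _ 1
    (gs.le_wedge _ _ 1 (by simpa using hp) (by simpa [pre] using gs.pre_zpow_gsup hΔ x))
    (by simpa using gs.Δ_mem)
  simpa [pp] using h

theorem subsingleton_of_Delta_eq_one (hΔ : gs.Δ = 1) : Subsingleton G := by
  have h : {s : G | s ∈ gs.P ∧ s⁻¹ * gs.Δ ∈ gs.P} ⊆ {1} := fun s hs =>
    gs.eq_one_of_mem_of_inv_mem s hs.1 (by simpa [hΔ] using hs.2)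
  rw [← Subgroup.subsingleton_iff]
  refine subsingleton_of_bot_eq_top ?_
  rw [← gs.simples_generate, eq_comm, Subgroup.closure_eq_bot_iff]
  exact h

theorem ginf_le_ginf_sl (hΔ : gs.Δ ≠ 1) (x : G) : gs.ginf x ≤ gs.ginf (gs.sl x) := by
  refine le_csSup (gs.bddAbove_zpow_pre hΔ _) ?_
  have h := gs.pp_pre_mul_zpow x
  rw [pre, ← mul_assoc, ← zpow_mul_mem_iff, zpow_neg] at h
  simpa [pre, sl, mul_assoc] using gs.mul_mem h (gs.pp_mem hΔ x)

theorem gsup_sl_le_gsup (hΔ : gs.Δ ≠ 1) (x : G) : gs.gsup (gs.sl x) ≤ gs.gsup x := by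
  refine csInf_le (gs.bddBelow_pre_zpow hΔ _) ?_
  have h := gs.mul_mem (gs.pp_pre_inv_mul_zpow x)
    ((gs.zpow_conj_mem_iff (gs.gsup x)).2 (gs.pp_mem hΔ x))
  simpa [pre, sl, mul_assoc] using h

end GarsideStructure

open GarsideStructure

variable {G : Type*} [Group G]

/-- Cyclic sliding does not decrease the infimum, does not increase the supremum and
does not increase the canonical length. -/
theorem cyclic_sliding_inf_sup_len (gs : GarsideStructure G) (x : G) :
    gs.ginf x ≤ gs.ginf (gs.sl x) ∧ gs.gsup (gs.sl x) ≤ gs.gsup x ∧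
      gs.glen (gs.sl x) ≤ gs.glen x := by
  by_cases hΔ : gs.Δ = 1
  · have := gs.subsingleton_of_Delta_eq_one hΔ
    simp [Subsingleton.elim (gs.sl x) x]
  · have hinf := gs.ginf_le_ginf_sl hΔ x
    have hsup := gs.gsup_sl_le_gsup hΔ x
    exact ⟨hinf, hsup, sub_le_sub hsup hinf⟩
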